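/- arXiv:2209.01004 — 4 statements merged into one kernel-verified Lean document; each statement's English description precedes it below -/
import Mathlib

section
/- Let f be a WG-drawing of a finite simple graph G with witness set P ⊆ ℝ². Let v, u1, v1 be three distinct vertices of G such that v is adjacent to u1 and v is adjacent to v1 in G. Then the closed triangle with vertices f(v), f(u1), f(v1) — that is, the convex hull of {f(v), f(u1), f(v1)} — contains no point of P. -/
noncomputable section

/-- The Euclidean plane. -/
abbrev Pt : Type := EuclideanSpace ℝ (Fin 2)

/-- The Gabriel disk `D[u,v]`: the closed disk having `u` and `v` as antipodal points. -/
def gabrielDisk (u v : Pt) : Set Pt := Metric.closedBall (midpoint ℝ u v) (dist u v / 2)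

/-- `f` is a witness Gabriel drawing of the finite simple graph `G` with witness set `P`. -/
def IsWGDrawing {V : Type*} [Fintype V] (G : SimpleGraph V) (f : V → Pt) (P : Set Pt) : Prop :=
  Function.Injective f ∧ Disjoint (Set.range f) P ∧
    ∀ u v : V, u ≠ v → (G.Adj u v ↔ gabrielDisk (f u) (f v) ∩ P = ∅)

/-- `⟨f₀, f₁⟩` is a mutual witness Gabriel drawing of the pair `⟨G₀, G₁⟩`. -/
def IsMWGDrawing {V₀ V₁ : Type*} [Fintype V₀] [Fintype V₁]
    (G₀ : SimpleGraph V₀) (G₁ : SimpleGraph V₁) (f₀ : V₀ → Pt) (f₁ : V₁ → Pt) : Prop :=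
  Function.Injective f₀ ∧ Function.Injective f₁ ∧
    Disjoint (Set.range f₀) (Set.range f₁) ∧
    (∀ u v : V₀, u ≠ v → (G₀.Adj u v ↔ gabrielDisk (f₀ u) (f₀ v) ∩ Set.range f₁ = ∅)) ∧
    (∀ u v : V₁, u ≠ v → (G₁.Adj u v ↔ gabrielDisk (f₁ u) (f₁ v) ∩ Set.range f₀ = ∅))

/-- Two subsets of the plane are linearly separable. -/
def LinSep (A B : Set Pt) : Prop :=
  ∃ (φ : Pt →ₗ[ℝ] ℝ) (c : ℝ), φ ≠ 0 ∧ (∀ a ∈ A, φ a < c) ∧ ∀ b ∈ B, c < φ b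

lemma mem_gabrielDisk_of_inner_nonpos {u v p : Pt} (h : inner ℝ (p - u) (p - v) ≤ 0) :
    p ∈ gabrielDisk u v := by
  have hm : p - midpoint ℝ u v = (2⁻¹ : ℝ) • ((p - u) + (p - v)) := by
    rw [midpoint_eq_smul_add, invOf_eq_inv]
    module
  have hd : dist u v = ‖(p - u) - (p - v)‖ := by
    rw [sub_sub_sub_cancel_left, dist_comm, dist_eq_norm]
  rw [gabrielDisk, Metric.mem_closedBall, dist_eq_norm, hm, hd, norm_smul, Real.norm_eq_abs,
    abs_of_pos (by norm_num)]
  have hle : ‖(p - u) + (p - v)‖ ≤ ‖(p - u) - (p - v)‖ := by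
    refine le_of_sq_le_sq ?_ (norm_nonneg _)
    linarith [norm_add_sq_real (p - u) (p - v), norm_sub_sq_real (p - u) (p - v)]
  linarith

lemma notMem_convexHull_of_notMem_gabrielDisk {a b c p : Pt} (hb : p ∉ gabrielDisk a b)
    (hc : p ∉ gabrielDisk a c) : p ∉ convexHull ℝ ({a, b, c} : Set Pt) := by
  have hb' : 0 < inner ℝ (p - a) (p - b) :=
    not_le.mp fun h => hb (mem_gabrielDisk_of_inner_nonpos h)
  have hc' : 0 < inner ℝ (p - a) (p - c) :=
    not_le.mp fun h => hc (mem_gabrielDisk_of_inner_nonpos h)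
  have ha' : 0 < inner ℝ (p - a) (p - a) := by
    refine real_inner_self_pos.mpr fun h => ?_
    simp [h] at hb'
  have hconv : Convex ℝ {x : Pt | inner ℝ (p - a) x < inner ℝ (p - a) p} :=
    convex_halfSpace_lt (innerₛₗ ℝ (p - a)).isLinear _
  intro hp
  have hsub : ({a, b, c} : Set Pt) ⊆ {x : Pt | inner ℝ (p - a) x < inner ℝ (p - a) p} := by
    rintro x (rfl | rfl | rfl) <;> rw [Set.mem_ofPred_eq, ← sub_pos, ← inner_sub_right] <;>
      assumption
  have hlt : inner ℝ (p - a) p < inner ℝ (p - a) p := convexHull_min hsub hconv hp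
  exact lt_irrefl _ hlt

/-- Property 1: if `v u₁` and `v v₁` are edges of a WG-drawing, then the closed triangle
`f v, f u₁, f v₁` contains no witness point. -/
theorem stmt0 {V : Type*} [Fintype V] (G : SimpleGraph V) (f : V → Pt) (P : Set Pt)
    (hWG : IsWGDrawing G f P) (v u₁ v₁ : V)
    (hvu : v ≠ u₁) (hvv : v ≠ v₁) (huv : u₁ ≠ v₁)
    (h₁ : G.Adj v u₁) (h₂ : G.Adj v v₁) :
    ∀ p ∈ P, p ∉ convexHull ℝ ({f v, f u₁, f v₁} : Set Pt) := by
  intro p hp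
  have hdisk {w : V} (hw : G.Adj v w) : p ∉ gabrielDisk (f v) (f w) := fun h =>
    Set.eq_empty_iff_forall_notMem.mp ((hWG.2.2 v w hw.ne).mp hw) p ⟨h, hp⟩
  exact notMem_convexHull_of_notMem_gabrielDisk (hdisk h₁) (hdisk h₂)
end
end

section
/- Let f be a WG-drawing of a finite simple graph G with witness set P ⊆ ℝ². Let u, v be distinct non-adjacent vertices of G, let p ∈ P be a witness for them (p ∈ D[f(u), f(v)]), and let z be a vertex of G adjacent to both u and v. Then f(z) lies in the open wedge W(p, f(u), f(v)): there exist real numbers s > 0 and t > 0 such that f(z) = p + s·(f(u) − p) + t·(f(v) − p). -/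
noncomputable section

/-- A point lies in the Gabriel disk of `u` and `v` iff it sees `u` and `v` at a non-acute angle. -/
lemma mem_gabrielDisk_iff (u v p : Pt) :
    p ∈ gabrielDisk u v ↔
      (u 0 - p 0) * (v 0 - p 0) + (u 1 - p 1) * (v 1 - p 1) ≤ 0 := by
  have hmid : ∀ i, midpoint ℝ u v i = (u i + v i) / 2 := fun i => by
    simp [midpoint_eq_smul_add]; ring
  rw [gabrielDisk, Metric.mem_closedBall, ← sq_le_sq₀ dist_nonneg (by positivity), div_pow,
    EuclideanSpace.dist_sq_eq, EuclideanSpace.dist_sq_eq]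
  simp only [Fin.sum_univ_two, Real.dist_eq, sq_abs, hmid]
  constructor <;> intro h <;> nlinarith

/-- In the plane, a vector making acute angles with both of two vectors that are at a non-acute
angle to each other is a positive combination of them. -/
lemma exists_pos_combination {a₀ a₁ c₀ c₁ w₀ w₁ : ℝ} (hac : a₀ * c₀ + a₁ * c₁ ≤ 0)
    (hwa : 0 < w₀ * a₀ + w₁ * a₁) (hwc : 0 < w₀ * c₀ + w₁ * c₁) :
    ∃ s t : ℝ, 0 < s ∧ 0 < t ∧ w₀ = s * a₀ + t * c₀ ∧ w₁ = s * a₁ + t * c₁ := by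
  have pos_of_pos : ∀ b₀ b₁ : ℝ, 0 < w₀ * b₀ + w₁ * b₁ → 0 < b₀ ^ 2 + b₁ ^ 2 := by
    intro b₀ b₁ h
    by_contra! hb
    have h0 : b₀ = 0 := by nlinarith [sq_nonneg b₀, sq_nonneg b₁]
    have h1 : b₁ = 0 := by nlinarith [sq_nonneg b₀, sq_nonneg b₁]
    simp [h0, h1] at h
  have hs : 0 < (w₀ * c₁ - w₁ * c₀) * (a₀ * c₁ - a₁ * c₀) := by
    nlinarith [mul_pos hwa (pos_of_pos _ _ hwc), mul_nonneg hwc.le (neg_nonneg.2 hac)]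
  have ht : 0 < (a₀ * w₁ - a₁ * w₀) * (a₀ * c₁ - a₁ * c₀) := by
    nlinarith [mul_pos hwc (pos_of_pos _ _ hwa), mul_nonneg hwa.le (neg_nonneg.2 hac)]
  have hd : a₀ * c₁ - a₁ * c₀ ≠ 0 := right_ne_zero_of_mul hs.ne'
  refine ⟨(w₀ * c₁ - w₁ * c₀) / (a₀ * c₁ - a₁ * c₀), (a₀ * w₁ - a₁ * w₀) / (a₀ * c₁ - a₁ * c₀),
    div_pos_iff.2 (mul_pos_iff.1 hs), div_pos_iff.2 (mul_pos_iff.1 ht), ?_, ?_⟩ <;>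
  · rw [div_mul_eq_mul_div, div_mul_eq_mul_div, ← add_div, eq_div_iff hd]
    ring

/-- Property 2: a common neighbor of a non-adjacent pair lies in the open wedge of any
of its witnesses. -/
theorem stmt1 {V : Type*} [Fintype V] (G : SimpleGraph V) (f : V → Pt) (P : Set Pt)
    (hWG : IsWGDrawing G f P) (u v : V) (huv : u ≠ v) (hnadj : ¬ G.Adj u v)
    (p : Pt) (hp : p ∈ P) (hpD : p ∈ gabrielDisk (f u) (f v))
    (z : V) (hzu : G.Adj z u) (hzv : G.Adj z v) :
    ∃ s t : ℝ, 0 < s ∧ 0 < t ∧ f z = p + s • (f u - p) + t • (f v - p) := by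
  have acute : ∀ x, G.Adj z x →
      0 < (f z 0 - p 0) * (f x 0 - p 0) + (f z 1 - p 1) * (f x 1 - p 1) := by
    intro x hx
    by_contra! h
    have hempty := (hWG.2.2 z x hx.ne).1 hx
    exact hempty.subset ⟨(mem_gabrielDisk_iff _ _ _).2 h, hp⟩
  obtain ⟨s, t, hs, ht, h0, h1⟩ :=
    exists_pos_combination ((mem_gabrielDisk_iff _ _ _).1 hpD) (acute u hzu) (acute v hzv)
  refine ⟨s, t, hs, ht, ?_⟩
  ext i
  fin_cases i <;> simp <;> linarith
end
end

section
/- Let ⟨f0, f1⟩ be an MWG-drawing of a pair ⟨G0, G1⟩ of finite simple graphs such that every point of the image of f0 has strictly positive y-coordinate and every point of the image of f1 has strictly negative y-coordinate. Let u0, u1 be distinct non-adjacent vertices of G0 with x(f0(u0)) < x(f0(u1)), and let z be a vertex of G1 with f1(z) ∈ D[f0(u0), f0(u1)]. Then x(f0(u0)) < x(f1(z)) < x(f0(u1)), and f1(z) lies strictly below the line through f0(u0) and f0(u1). -/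
noncomputable section

/-- A point of the Gabriel disk sees its diameter under a non-acute angle. -/
theorem gabrielDisk_coord_le {u v p : Pt} (hp : p ∈ gabrielDisk u v) :
    (p 0 - u 0) * (p 0 - v 0) + (p 1 - u 1) * (p 1 - v 1) ≤ 0 := by
  have hmid : ∀ i, midpoint ℝ u v i = (u i + v i) / 2 := fun i => by
    simp [midpoint_eq_smul_add]
    ring
  rw [gabrielDisk, Metric.mem_closedBall] at hp
  have hsq := pow_le_pow_left₀ dist_nonneg hp 2
  rw [div_pow, EuclideanSpace.dist_sq_eq, EuclideanSpace.dist_sq_eq] at hsq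
  simp only [Fin.sum_univ_two, Real.dist_eq, sq_abs, hmid] at hsq
  linarith

/-- A witness of a non-edge of `Γ₀` lies in the open near half-strip of the non-edge. -/
theorem stmt2 {V₀ V₁ : Type*} [Fintype V₀] [Fintype V₁]
    (G₀ : SimpleGraph V₀) (G₁ : SimpleGraph V₁) (f₀ : V₀ → Pt) (f₁ : V₁ → Pt)
    (hMWG : IsMWGDrawing G₀ G₁ f₀ f₁)
    (hy₀ : ∀ u, 0 < f₀ u 1) (hy₁ : ∀ v, f₁ v 1 < 0)
    (u₀ u₁ : V₀) (hne : u₀ ≠ u₁) (hnadj : ¬ G₀.Adj u₀ u₁)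
    (hx : f₀ u₀ 0 < f₀ u₁ 0)
    (z : V₁) (hz : f₁ z ∈ gabrielDisk (f₀ u₀) (f₀ u₁)) :
    (f₀ u₀ 0 < f₁ z 0 ∧ f₁ z 0 < f₀ u₁ 0) ∧
      (f₀ u₁ 0 - f₀ u₀ 0) * (f₁ z 1 - f₀ u₀ 1) <
        (f₀ u₁ 1 - f₀ u₀ 1) * (f₁ z 0 - f₀ u₀ 0) := by
  have hdisk := gabrielDisk_coord_le hz
  have ha := hy₀ u₀
  have hb := hy₀ u₁
  have hw := hy₁ z
  have hpos : 0 < (f₁ z 1 - f₀ u₀ 1) * (f₁ z 1 - f₀ u₁ 1) :=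
    mul_pos_of_neg_of_neg (by linarith) (by linarith)
  have hneg : (f₁ z 0 - f₀ u₀ 0) * (f₁ z 0 - f₀ u₁ 0) < 0 := by linarith
  obtain ⟨h₁, h₂⟩ | ⟨h₁, h₂⟩ := mul_neg_iff.mp hneg
  · refine ⟨⟨by linarith, by linarith⟩, ?_⟩
    have hb' := mul_pos hb h₁
    have ha' := mul_neg_of_pos_of_neg ha h₂
    have hw' := mul_neg_of_neg_of_pos hw (sub_pos.mpr hx)
    linarith
  · linarith
end
end

section
/- Let f be a WG-drawing of a finite simple graph G with witness set P ⊆ ℝ² such that every point of the image of f has strictly positive y-coordinate and every point of P has strictly negative y-coordinate. Let u0, u1, v0, v1 be four distinct vertices inducing a 4-cycle in G: u0v0, v0u1, u1v1, v1u0 are edges of G and u0u1, v0v1 are non-edges. Assume x(f(u0)) < x(f(u1)). Then: (i) f(v0) and f(v1) lie strictly on opposite sides of the line through f(u0) and f(u1); and (ii) there is a labeling {w, w'} = {v0, v1} such that x(f(u0)) < x(f(w)) < x(f(u1)) and f(w) lies strictly below the line through f(u0) and f(u1), while x(f(w')) < x(f(u0)) or x(f(w')) > x(f(u1)). -/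
noncomputable section

/-- A vector of the upper half-plane making acute angles with both sides of a (right or obtuse)
upward wedge lies inside the wedge. -/
lemma above_left_ray {ax ay bx b_y cx cy : ℝ} (hax : ax < 0)
    (hay : 0 < ay) (hby : 0 < b_y) (hcy : 0 < cy) (hab : ax * bx + ay * b_y ≤ 0)
    (hbc : 0 < bx * cx + b_y * cy) : ay / ax * cx < cy := by
  have key : 0 < cx * ay - cy * ax := by
    rcases le_or_gt 0 cx with h | h
    · nlinarith [mul_nonneg h hay.le, mul_pos hcy (neg_pos.2 hax)]
    · have h1 := mul_pos hbc (neg_pos.2 hax)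
      have h2 := mul_nonneg (neg_nonneg.2 hab) (neg_pos.2 h).le
      have h3 : 0 < b_y * (cx * ay - cy * ax) := by nlinarith
      exact pos_of_mul_pos_right h3 hby.le
  rw [div_mul_eq_mul_div, div_lt_iff_of_neg hax]
  linarith

/-- An upward wedge with a right or obtuse angle at `(px, p_y)`, described by the slopes `s`, `t`
of its two sides. -/
lemma exists_wedge_slopes {ax ay bx b_y px p_y : ℝ} (hlt : ax < bx) (hay : p_y < ay)
    (hby : p_y < b_y) (hab : (ax - px) * (bx - px) + (ay - p_y) * (b_y - p_y) ≤ 0) :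
    ax < px ∧ px < bx ∧ ∃ s t : ℝ, s < 0 ∧ 0 < t ∧
      ay - p_y = s * (ax - px) ∧ b_y - p_y = t * (bx - px) ∧
      ∀ cx cy : ℝ, p_y < cy → 0 < (ax - px) * (cx - px) + (ay - p_y) * (cy - p_y) →
        0 < (bx - px) * (cx - px) + (b_y - p_y) * (cy - p_y) →
        s * (cx - px) < cy - p_y ∧ t * (cx - px) < cy - p_y := by
  have hneg : (ax - px) * (bx - px) < 0 := by
    have := mul_pos (sub_pos.2 hay) (sub_pos.2 hby)
    linarith
  obtain ⟨ha, hb⟩ : ax - px < 0 ∧ 0 < bx - px := by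
    rcases mul_neg_iff.1 hneg with h | h
    · linarith [h.1, h.2]
    · exact h
  refine ⟨by linarith, by linarith, (ay - p_y) / (ax - px), (b_y - p_y) / (bx - px),
    div_neg_of_pos_of_neg (by linarith) ha, div_pos (by linarith) hb,
    (div_mul_cancel₀ _ ha.ne).symm, (div_mul_cancel₀ _ hb.ne').symm, ?_⟩
  intro cx cy hc hac hbc
  refine ⟨above_left_ray ha (by linarith) (by linarith) (by linarith) hab hbc, ?_⟩
  have h := above_left_ray (ax := -(bx - px)) (bx := -(ax - px)) (cx := -(cx - px))
    (ay := b_y - p_y) (b_y := ay - p_y) (cy := cy - p_y) (by linarith)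
    (by linarith) (by linarith) (by linarith) (by linarith) (by linarith)
  rwa [div_neg, neg_mul_neg] at h

/-- If the angle at the origin between `(cx, cy)` and `(dx, d_y)` is right or obtuse, every point
of the wedge lower than both endpoints lies in the disk with these endpoints as antipodes. -/
lemma inner_nonpos_of_mem_wedge {cx cy dx d_y px p_y s t : ℝ} (hc : cx < 0) (hd : 0 < dx)
    (hs : s < 0) (ht : 0 < t) (hcy : cy = s * cx) (hdy : d_y = t * dx)
    (hcd : cx * dx + cy * d_y ≤ 0) (h1 : s * px ≤ p_y) (h2 : t * px ≤ p_y)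
    (h3 : p_y ≤ cy) (h4 : p_y ≤ d_y) :
    (cx - px) * (dx - px) + (cy - p_y) * (d_y - p_y) ≤ 0 := by
  obtain ⟨l, hl⟩ : ∃ l, l = (p_y - t * px) / (-cx * (t - s)) := ⟨_, rfl⟩
  obtain ⟨m, hm⟩ : ∃ m, m = (p_y - s * px) / (dx * (t - s)) := ⟨_, rfl⟩
  have hts : 0 < t - s := by linarith
  have hc0 : cx ≠ 0 := hc.ne
  have hl0 : 0 ≤ l := hl ▸ div_nonneg (by linarith) (mul_pos (by linarith) hts).le
  have hm0 : 0 ≤ m := hm ▸ div_nonneg (by linarith) (mul_pos hd hts).le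
  have hpx : px = l * cx + m * dx := by
    rw [hl, hm]
    field_simp
    ring
  have hpy : p_y = l * cy + m * d_y := by
    rw [hl, hm, hcy, hdy]
    field_simp
    ring
  have hcy0 : 0 < cy := hcy ▸ mul_pos_of_neg_of_neg hs hc
  have hdy0 : 0 < d_y := hdy ▸ mul_pos ht hd
  have hlm : l + m ≤ 1 := by
    by_contra! hcon
    have hp0 : 0 < p_y := by
      rw [hpy]
      rcases hl0.eq_or_lt with h | h
      · have : 0 < m := by linarith
        positivity
      · positivity
    nlinarith [mul_le_mul_of_nonneg_left h3 hl0, mul_le_mul_of_nonneg_left h4 hm0]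
  have hexp : (cx - px) * (dx - px) + (cy - p_y) * (d_y - p_y) =
      -((1 - l) * l * (cx ^ 2 + cy ^ 2)) - m * (1 - m) * (dx ^ 2 + d_y ^ 2) +
        ((1 - l) * (1 - m) + l * m) * (cx * dx + cy * d_y) := by
    rw [hpx, hpy]
    ring
  have e1 : 0 ≤ (1 - l) * l * (cx ^ 2 + cy ^ 2) :=
    mul_nonneg (mul_nonneg (by linarith) hl0) (by positivity)
  have e2 : 0 ≤ m * (1 - m) * (dx ^ 2 + d_y ^ 2) :=
    mul_nonneg (mul_nonneg hm0 (by linarith)) (by positivity)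
  have e3 : ((1 - l) * (1 - m) + l * m) * (cx * dx + cy * d_y) ≤ 0 :=
    mul_nonpos_of_nonneg_of_nonpos
      (add_nonneg (mul_nonneg (by linarith) (by linarith)) (mul_nonneg hl0 hm0)) hcd
  linarith

/-- `p` sees `a`, `b` under a right or obtuse angle and every pair joining `{a, b}` to
`{c, d}` under an acute one; all four points lie above `p`. -/
structure SeparatesPair (px p_y ax ay bx b_y cx cy dx d_y : ℝ) : Prop where
  ha : p_y < ay
  hb : p_y < b_y
  hc : p_y < cy
  hd : p_y < d_y
  hab : (ax - px) * (bx - px) + (ay - p_y) * (b_y - p_y) ≤ 0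
  hac : 0 < (ax - px) * (cx - px) + (ay - p_y) * (cy - p_y)
  had : 0 < (ax - px) * (dx - px) + (ay - p_y) * (d_y - p_y)
  hbc : 0 < (bx - px) * (cx - px) + (b_y - p_y) * (cy - p_y)
  hbd : 0 < (bx - px) * (dx - px) + (b_y - p_y) * (d_y - p_y)

lemma SeparatesPair.hcd {px p_y ax ay bx b_y cx cy dx d_y : ℝ}
    (h : SeparatesPair px p_y ax ay bx b_y cx cy dx d_y) :
    0 < (cx - px) * (dx - px) + (cy - p_y) * (d_y - p_y) := by
  have hA : 0 < (ax - px) ^ 2 + (ay - p_y) ^ 2 := by nlinarith [sub_pos.2 h.ha]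
  have hB : 0 < (bx - px) ^ 2 + (b_y - p_y) ^ 2 := by nlinarith [sub_pos.2 h.hb]
  have e1 := mul_pos (mul_pos h.hac h.had) hB
  have e2 := mul_pos (mul_pos h.hbc h.hbd) hA
  have e3 := mul_nonneg (neg_nonneg.2 h.hab)
    (add_pos (mul_pos h.hac h.hbd) (mul_pos h.hbc h.had)).le
  refine pos_of_mul_pos_right (a := ((ax - px) * (b_y - p_y) - (ay - p_y) * (bx - px)) ^ 2) ?_
    (sq_nonneg _)
  linarith

lemma SeparatesPair.swap_right {px p_y ax ay bx b_y cx cy dx d_y : ℝ}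
    (h : SeparatesPair px p_y ax ay bx b_y cx cy dx d_y) :
    SeparatesPair px p_y ax ay bx b_y dx d_y cx cy :=
  ⟨h.ha, h.hb, h.hd, h.hc, h.hab, h.had, h.hac, h.hbd, h.hbc⟩

lemma SeparatesPair.swap_left {px p_y ax ay bx b_y cx cy dx d_y : ℝ}
    (h : SeparatesPair px p_y ax ay bx b_y cx cy dx d_y) :
    SeparatesPair px p_y bx b_y ax ay cx cy dx d_y :=
  ⟨h.hb, h.ha, h.hc, h.hd, by linarith [h.hab], h.hbc, h.hbd, h.hac, h.had⟩

lemma SeparatesPair.reflect {px p_y ax ay bx b_y cx cy dx d_y : ℝ}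
    (h : SeparatesPair px p_y ax ay bx b_y cx cy dx d_y) :
    SeparatesPair (-px) p_y (-ax) ay (-bx) b_y (-cx) cy (-dx) d_y :=
  ⟨h.ha, h.hb, h.hc, h.hd, by linarith [h.hab], by linarith [h.hac],
    by linarith [h.had], by linarith [h.hbc], by linarith [h.hbd]⟩

/-- The position of two mutually separated pairs whose witnesses satisfy `px ≤ qx`. -/
lemma separatesPair_position {px p_y qx qy ax ay bx b_y cx cy dx d_y : ℝ}
    (hp : SeparatesPair px p_y ax ay bx b_y cx cy dx d_y)
    (hq : SeparatesPair qx qy cx cy dx d_y ax ay bx b_y)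
    (hab : ax < bx) (hcd : cx < dx) (hpq : px ≤ qx) :
    ax < cx ∧ cx < bx ∧ bx < dx ∧
      (bx - ax) * (cy - ay) < (b_y - ay) * (cx - ax) ∧
      (b_y - ay) * (dx - ax) < (bx - ax) * (d_y - ay) := by
  obtain ⟨hap, hpb, s, s', hs, hs', hsa, hsb, hS⟩ :=
    exists_wedge_slopes hab hp.ha hp.hb hp.hab
  obtain ⟨hcq, hqd, t, t', ht, ht', htc, htd, hT⟩ :=
    exists_wedge_slopes hcd hq.ha hq.hb hq.hab
  obtain ⟨hc1, hc2⟩ := hS cx cy hp.hc hp.hac hp.hbc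
  obtain ⟨hd1, hd2⟩ := hS dx d_y hp.hd hp.had hp.hbd
  obtain ⟨ha1, ha2⟩ := hT ax ay hq.hc hq.hac hq.hbc
  obtain ⟨hb1, hb2⟩ := hT bx b_y hq.hd hq.had hq.hbd
  have hp_out : ¬ (t * (px - qx) ≤ p_y - qy ∧ t' * (px - qx) ≤ p_y - qy) := by
    rintro ⟨h1, h2⟩
    have := inner_nonpos_of_mem_wedge (sub_neg.2 hcq) (sub_pos.2 hqd) ht ht' htc htd hq.hab h1 h2
      (by linarith [hp.hc]) (by linarith [hp.hd])
    linarith [hp.hcd]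
  have hq_out : ¬ (s * (qx - px) ≤ qy - p_y ∧ s' * (qx - px) ≤ qy - p_y) := by
    rintro ⟨h1, h2⟩
    have := inner_nonpos_of_mem_wedge (sub_neg.2 hap) (sub_pos.2 hpb) hs hs' hsa hsb hp.hab h1 h2
      (by linarith [hq.hc]) (by linarith [hq.hd])
    linarith [hq.hcd]
  have hac : ax < cx := by
    by_contra! hca
    have hts : t < s := by
      by_contra! h
      linarith [mul_nonneg (sub_nonneg.2 hca) (sub_nonneg.2 h)]
    have h1 : t * (px - qx) ≤ p_y - qy := by
      linarith [mul_pos (sub_pos.2 hap) (sub_pos.2 hts)]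
    exact hp_out ⟨h1, by linarith [mul_nonneg (sub_nonneg.2 hpq) (by linarith : 0 ≤ t' - t)]⟩
  have hbd : bx < dx := by
    by_contra! hdb
    have hts : t' < s' := by
      by_contra! h
      linarith [mul_nonneg (sub_nonneg.2 hdb) (sub_nonneg.2 h)]
    have h1 : s' * (qx - px) ≤ qy - p_y := by
      linarith [mul_pos (sub_pos.2 hqd) (sub_pos.2 hts)]
    exact hq_out ⟨by linarith [mul_nonneg (sub_nonneg.2 hpq) (by linarith : 0 ≤ s' - s)], h1⟩
  have hcb : cx < bx := by
    by_contra! hbc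
    linarith [mul_nonneg (sub_nonneg.2 hbc) (by linarith : 0 ≤ s' - t)]
  refine ⟨hac, hcb, hbd, ?_, ?_⟩
  · have h1 : 0 < (ay - cy) - t * (ax - cx) := by linarith
    have h2 : 0 < (b_y - cy) - t * (bx - cx) := by linarith
    linarith [mul_pos h1 (sub_pos.2 hcb), mul_pos h2 (sub_pos.2 hac)]
  · have h1 : 0 < (d_y - b_y) - s' * (dx - bx) := by linarith
    have h2 : 0 < (ay - b_y) - s' * (ax - bx) := by
      have e : (ay - b_y) - s' * (ax - bx) = (s' - s) * (px - ax) := by linarith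
      rw [e]
      exact mul_pos (by linarith) (by linarith)
    linarith [mul_pos h1 (sub_pos.2 hab), mul_pos h2 (sub_pos.2 hbd)]

/-- The position of two mutually separated pairs. -/
lemma separatesPair_position_or {px p_y qx qy ax ay bx b_y cx cy dx d_y : ℝ}
    (hp : SeparatesPair px p_y ax ay bx b_y cx cy dx d_y)
    (hq : SeparatesPair qx qy cx cy dx d_y ax ay bx b_y)
    (hab : ax < bx) (hcd : cx < dx) :
    (ax < cx ∧ cx < bx ∧ bx < dx ∧
      (bx - ax) * (cy - ay) < (b_y - ay) * (cx - ax) ∧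
      (b_y - ay) * (dx - ax) < (bx - ax) * (d_y - ay)) ∨
    (ax < dx ∧ dx < bx ∧ cx < ax ∧
      (bx - ax) * (d_y - ay) < (b_y - ay) * (dx - ax) ∧
      (b_y - ay) * (cx - ax) < (bx - ax) * (cy - ay)) := by
  rcases le_total px qx with h | h
  · exact Or.inl (separatesPair_position hp hq hab hcd h)
  · obtain ⟨h1, h2, h3, h4, h5⟩ := separatesPair_position hp.reflect.swap_left.swap_right
      hq.reflect.swap_left.swap_right (neg_lt_neg hab) (neg_lt_neg hcd) (neg_le_neg h)
    exact Or.inr ⟨by linarith, by linarith, by linarith, by linarith, by linarith⟩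

/-- Lemma 7: position of the vertices of an induced 4-cycle in a linearly separated
WG-drawing. -/
theorem stmt12 {V : Type*} [Fintype V] (G : SimpleGraph V) (f : V → Pt) (P : Set Pt)
    (hWG : IsWGDrawing G f P)
    (hy : ∀ v, 0 < f v 1) (hP : ∀ p ∈ P, p 1 < 0)
    (u₀ u₁ v₀ v₁ : V)
    (h01 : u₀ ≠ u₁) (h02 : u₀ ≠ v₀) (h03 : u₀ ≠ v₁)
    (h12 : u₁ ≠ v₀) (h13 : u₁ ≠ v₁) (h23 : v₀ ≠ v₁)
    (he₀ : G.Adj u₀ v₀) (he₁ : G.Adj v₀ u₁) (he₂ : G.Adj u₁ v₁) (he₃ : G.Adj v₁ u₀)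
    (hn₀ : ¬ G.Adj u₀ u₁) (hn₁ : ¬ G.Adj v₀ v₁)
    (hx : f u₀ 0 < f u₁ 0) :
    ((f u₁ 0 - f u₀ 0) * (f v₀ 1 - f u₀ 1) - (f u₁ 1 - f u₀ 1) * (f v₀ 0 - f u₀ 0)) *
      ((f u₁ 0 - f u₀ 0) * (f v₁ 1 - f u₀ 1) - (f u₁ 1 - f u₀ 1) * (f v₁ 0 - f u₀ 0)) < 0 ∧
    ((f u₀ 0 < f v₀ 0 ∧ f v₀ 0 < f u₁ 0 ∧
        (f u₁ 0 - f u₀ 0) * (f v₀ 1 - f u₀ 1) < (f u₁ 1 - f u₀ 1) * (f v₀ 0 - f u₀ 0) ∧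
        (f v₁ 0 < f u₀ 0 ∨ f u₁ 0 < f v₁ 0)) ∨
     (f u₀ 0 < f v₁ 0 ∧ f v₁ 0 < f u₁ 0 ∧
        (f u₁ 0 - f u₀ 0) * (f v₁ 1 - f u₀ 1) < (f u₁ 1 - f u₀ 1) * (f v₁ 0 - f u₀ 0) ∧
        (f v₀ 0 < f u₀ 0 ∨ f u₁ 0 < f v₀ 0))) := by
  
  have hne : ∀ u v : V, u ≠ v → ¬ G.Adj u v → ∃ p ∈ P,
      (f u 0 - p 0) * (f v 0 - p 0) + (f u 1 - p 1) * (f v 1 - p 1) ≤ 0 := by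
    intro u v huv h
    rw [hWG.2.2 u v huv] at h
    obtain ⟨p, hpd, hpP⟩ := Set.nonempty_iff_ne_empty.2 h
    exact ⟨p, hpP, (mem_gabrielDisk_iff _ _ _).1 hpd⟩
  have hadj : ∀ u v : V, G.Adj u v → ∀ p ∈ P,
      0 < (f u 0 - p 0) * (f v 0 - p 0) + (f u 1 - p 1) * (f v 1 - p 1) := by
    intro u v h p hp
    by_contra! hle
    exact (Set.eq_empty_iff_forall_notMem.1 ((hWG.2.2 u v h.ne).1 h)) p
      ⟨(mem_gabrielDisk_iff _ _ _).2 hle, hp⟩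
  have hlow : ∀ p ∈ P, ∀ v, p 1 < f v 1 := fun p hp v => (hP p hp).trans (hy v)
  obtain ⟨p, hpP, hp⟩ := hne u₀ u₁ h01 hn₀
  obtain ⟨q, hqP, hq⟩ := hne v₀ v₁ h23 hn₁
  have hsep : SeparatesPair (p 0) (p 1) (f u₀ 0) (f u₀ 1) (f u₁ 0) (f u₁ 1)
      (f v₀ 0) (f v₀ 1) (f v₁ 0) (f v₁ 1) :=
    ⟨hlow p hpP _, hlow p hpP _, hlow p hpP _, hlow p hpP _, hp, hadj _ _ he₀ p hpP,
      hadj _ _ he₃.symm p hpP, hadj _ _ he₁.symm p hpP, hadj _ _ he₂ p hpP⟩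
  have hsep' : SeparatesPair (q 0) (q 1) (f v₀ 0) (f v₀ 1) (f v₁ 0) (f v₁ 1)
      (f u₀ 0) (f u₀ 1) (f u₁ 0) (f u₁ 1) :=
    ⟨hlow q hqP _, hlow q hqP _, hlow q hqP _, hlow q hqP _, hq, hadj _ _ he₀.symm q hqP,
      hadj _ _ he₁ q hqP, hadj _ _ he₃ q hqP, hadj _ _ he₂.symm q hqP⟩
  rcases lt_trichotomy (f v₀ 0) (f v₁ 0) with h | h | h
  · rcases separatesPair_position_or hsep hsep' hx h with ⟨h1, h2, h3, h4, h5⟩ | ⟨h1, h2, h3, h4, h5⟩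
    · exact ⟨mul_neg_of_neg_of_pos (sub_neg.2 h4) (sub_pos.2 h5), Or.inl ⟨h1, h2, h4, Or.inr h3⟩⟩
    · exact ⟨mul_neg_of_pos_of_neg (sub_pos.2 h5) (sub_neg.2 h4), Or.inr ⟨h1, h2, h4, Or.inl h3⟩⟩
  · rw [h] at hq
    nlinarith [mul_self_nonneg (f v₁ 0 - q 0),
      mul_pos (sub_pos.2 (hlow q hqP v₀)) (sub_pos.2 (hlow q hqP v₁))]
  · rcases separatesPair_position_or hsep.swap_right hsep'.swap_left hx h with
      ⟨h1, h2, h3, h4, h5⟩ | ⟨h1, h2, h3, h4, h5⟩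
    · exact ⟨mul_neg_of_pos_of_neg (sub_pos.2 h5) (sub_neg.2 h4), Or.inr ⟨h1, h2, h4, Or.inr h3⟩⟩
    · exact ⟨mul_neg_of_neg_of_pos (sub_neg.2 h4) (sub_pos.2 h5), Or.inl ⟨h1, h2, h4, Or.inl h3⟩⟩
end
end
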